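/- Jacobi eigenfields from the rotated Hopf field (proof of Theorem 3.1): in the S⁴ frame setup, defining J Ω₁ := cosh θ · ψ₄ and J Ω₂ := −sinh θ · ψ₃ (the action of the almost complex structure J with J ψ₃ = ψ₄, J ψ₄ = −ψ₃), one has 𝓛(J Ω₁) = 2 J Ω₁ and 𝓛(J Ω₂) = 2 J Ω₂ pointwise on ℂ. -/

import Mathlib

open Complex

noncomputable section

/-- Wirtinger derivative `∂_z` of a map `ℂ → ℂ`. -/
def wirtZ (g : ℂ → ℂ) (z : ℂ) : ℂ :=
  (1 / 2 : ℂ) * (fderiv ℝ g z 1 - Complex.I * fderiv ℝ g z Complex.I)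

/-- Wirtinger derivative `∂_z̄` of a map `ℂ → ℂ`. -/
def wirtZbar (g : ℂ → ℂ) (z : ℂ) : ℂ :=
  (1 / 2 : ℂ) * (fderiv ℝ g z 1 + Complex.I * fderiv ℝ g z Complex.I)

/-- Componentwise `∂_z` for vector-valued maps. -/
def WZ {m : ℕ} (g : ℂ → Fin m → ℂ) : ℂ → Fin m → ℂ :=
  fun z i => wirtZ (fun w => g w i) z

/-- Componentwise `∂_z̄` for vector-valued maps. -/
def WZb {m : ℕ} (g : ℂ → Fin m → ℂ) : ℂ → Fin m → ℂ :=
  fun z i => wirtZbar (fun w => g w i) z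

/-- Complex-bilinear (non-conjugating) pairing. -/
def pairC {m : ℕ} (u v : Fin m → ℂ) : ℂ := ∑ i, u i * v i

/-- Componentwise complex conjugation. -/
def conjV {m : ℕ} (u : Fin m → ℂ) : Fin m → ℂ := fun i => (starRingEnd ℂ) (u i)

/-- Complexification of a real vector. -/
def cV {m : ℕ} (u : Fin m → ℝ) : Fin m → ℂ := fun i => (u i : ℂ)

/-- Complexification of a real-vector-valued map. -/
def Fc {m : ℕ} (f : ℂ → Fin m → ℝ) : ℂ → Fin m → ℂ := fun z => cV (f z)

/-- `∂_z` of (the complexification of) a real-valued function. -/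
def dZ (ρ : ℂ → ℝ) (z : ℂ) : ℂ := wirtZ (fun w => ((ρ w : ℝ) : ℂ)) z

/-- `f : ℂ → S^n ⊂ ℝ^{n+1}` is a conformal minimal immersion with conformal factor `ρ`:
`⟨f_z, f_z⟩ = 0`, `⟨f_z, f̄_z⟩ = (1/2) e^{2ρ}`, and `f_{z z̄} = −(1/2) e^{2ρ} f`. -/
def IsConfMinImm {m : ℕ} (f : ℂ → Fin m → ℝ) (ρ : ℂ → ℝ) : Prop :=
  ContDiff ℝ (⊤ : ℕ∞) f ∧ ContDiff ℝ (⊤ : ℕ∞) ρ ∧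
  (∀ z, ∑ i, (f z i) ^ 2 = 1) ∧
  (∀ z, pairC (WZ (Fc f) z) (WZ (Fc f) z) = 0) ∧
  (∀ z, pairC (WZ (Fc f) z) (conjV (WZ (Fc f) z)) = (1 / 2 : ℂ) * (Real.exp (2 * ρ z) : ℂ)) ∧
  (∀ z i, WZb (WZ (Fc f)) z i = -(1 / 2 : ℂ) * (Real.exp (2 * ρ z) : ℂ) * Fc f z i)

/-- The Hopf field `Ω = f_{zz} − 2 ρ_z f_z`. -/
def Hopf {m : ℕ} (f : ℂ → Fin m → ℝ) (ρ : ℂ → ℝ) : ℂ → Fin m → ℂ :=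
  fun z i => WZ (WZ (Fc f)) z i - 2 * dZ ρ z * WZ (Fc f) z i

/-- Real part `Ω₁` of the Hopf field, viewed in `ℂ^{n+1}`. -/
def HopfRe {m : ℕ} (f : ℂ → Fin m → ℝ) (ρ : ℂ → ℝ) : ℂ → Fin m → ℂ :=
  fun z i => ((Hopf f ρ z i).re : ℂ)

/-- Imaginary part `Ω₂` of the Hopf field, viewed in `ℂ^{n+1}`. -/
def HopfIm {m : ℕ} (f : ℂ → Fin m → ℝ) (ρ : ℂ → ℝ) : ℂ → Fin m → ℂ :=
  fun z i => ((Hopf f ρ z i).im : ℂ)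

/-- Normal projection `E^⊥` of a constant vector `E ∈ ℝ^{n+1}`. -/
def Eperp {m : ℕ} (f : ℂ → Fin m → ℝ) (ρ : ℂ → ℝ) (E : Fin m → ℝ) : ℂ → Fin m → ℂ :=
  fun z i => (E i : ℂ) - pairC (cV E) (Fc f z) * Fc f z i
    - 2 * (Real.exp (-2 * ρ z) : ℂ) * pairC (cV E) (WZ (Fc f) z) * WZb (Fc f) z i
    - 2 * (Real.exp (-2 * ρ z) : ℂ) * pairC (cV E) (WZb (Fc f) z) * WZ (Fc f) z i

/-- `ψ` is a normal field along `f`. -/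
def IsNormalField {m : ℕ} (f : ℂ → Fin m → ℝ) (ψ : ℂ → Fin m → ℂ) : Prop :=
  ∀ z, pairC (ψ z) (Fc f z) = 0 ∧ pairC (ψ z) (WZ (Fc f) z) = 0 ∧
    pairC (ψ z) (WZb (Fc f) z) = 0

/-- Normal covariant derivative `N_z ψ = ψ_z + 2 e^{−2ρ} ⟨ψ, Ω⟩ f_z̄`. -/
def NZ {m : ℕ} (f : ℂ → Fin m → ℝ) (ρ : ℂ → ℝ) (ψ : ℂ → Fin m → ℂ) : ℂ → Fin m → ℂ :=
  fun z i => WZ ψ z i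
    + 2 * (Real.exp (-2 * ρ z) : ℂ) * pairC (ψ z) (Hopf f ρ z) * WZb (Fc f) z i

/-- Normal covariant derivative `N_z̄ ψ = ψ_z̄ + 2 e^{−2ρ} ⟨ψ, Ω̄⟩ f_z`. -/
def NZb {m : ℕ} (f : ℂ → Fin m → ℝ) (ρ : ℂ → ℝ) (ψ : ℂ → Fin m → ℂ) : ℂ → Fin m → ℂ :=
  fun z i => WZb ψ z i
    + 2 * (Real.exp (-2 * ρ z) : ℂ) * pairC (ψ z) (conjV (Hopf f ρ z)) * WZ (Fc f) z i

/-- Normal Laplacian `Δ^⊥ ψ = 2 e^{−2ρ} (N_z̄ (N_z ψ) + N_z (N_z̄ ψ))`. -/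
def LapPerp {m : ℕ} (f : ℂ → Fin m → ℝ) (ρ : ℂ → ℝ) (ψ : ℂ → Fin m → ℂ) : ℂ → Fin m → ℂ :=
  fun z i => 2 * (Real.exp (-2 * ρ z) : ℂ) * (NZb f ρ (NZ f ρ ψ) z i + NZ f ρ (NZb f ρ ψ) z i)

/-- Jacobi operator `𝓛 ψ = Δ^⊥ ψ + 2 ψ + 4 e^{−4ρ} (⟨ψ, Ω⟩ Ω̄ + ⟨ψ, Ω̄⟩ Ω)`. -/
def Jacobi {m : ℕ} (f : ℂ → Fin m → ℝ) (ρ : ℂ → ℝ) (ψ : ℂ → Fin m → ℂ) : ℂ → Fin m → ℂ :=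
  fun z i => LapPerp f ρ ψ z i + 2 * ψ z i
    + 4 * (Real.exp (-4 * ρ z) : ℂ) *
      (pairC (ψ z) (Hopf f ρ z) * conjV (Hopf f ρ z) i
        + pairC (ψ z) (conjV (Hopf f ρ z)) * Hopf f ρ z i)

/-- The S⁴ adapted frame setup: `⟨Ω, Ω⟩ ≡ 1`, `Ω₁ = cosh θ · ψ₃`, `Ω₂ = sinh θ · ψ₄`
with `ψ₃, ψ₄` orthonormal normal fields. -/
def S4Frame (f : ℂ → Fin 5 → ℝ) (ρ : ℂ → ℝ) (ψ₃ ψ₄ : ℂ → Fin 5 → ℝ) (θ : ℂ → ℝ) : Prop :=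
  ContDiff ℝ (⊤ : ℕ∞) ψ₃ ∧ ContDiff ℝ (⊤ : ℕ∞) ψ₄ ∧ ContDiff ℝ (⊤ : ℕ∞) θ ∧
  IsNormalField f (Fc ψ₃) ∧ IsNormalField f (Fc ψ₄) ∧
  (∀ z, ∑ i, (ψ₃ z i) ^ 2 = 1) ∧ (∀ z, ∑ i, (ψ₄ z i) ^ 2 = 1) ∧
  (∀ z, ∑ i, ψ₃ z i * ψ₄ z i = 0) ∧
  (∀ z, pairC (Hopf f ρ z) (Hopf f ρ z) = 1) ∧
  (∀ z i, (Hopf f ρ z i).re = Real.cosh (θ z) * ψ₃ z i) ∧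
  (∀ z i, (Hopf f ρ z i).im = Real.sinh (θ z) * ψ₄ z i)

section Wirtinger

variable {g h : ℂ → ℂ} {z : ℂ}

theorem wirtZ_add (hg : DifferentiableAt ℝ g z) (hh : DifferentiableAt ℝ h z) :
    wirtZ (fun w => g w + h w) z = wirtZ g z + wirtZ h z := by
  simp only [wirtZ, fderiv_fun_add hg hh, add_apply]
  ring

theorem wirtZbar_add (hg : DifferentiableAt ℝ g z) (hh : DifferentiableAt ℝ h z) :
    wirtZbar (fun w => g w + h w) z = wirtZbar g z + wirtZbar h z := by
  simp only [wirtZbar, fderiv_fun_add hg hh, add_apply]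
  ring

theorem wirtZ_mul (hg : DifferentiableAt ℝ g z) (hh : DifferentiableAt ℝ h z) :
    wirtZ (fun w => g w * h w) z = wirtZ g z * h z + g z * wirtZ h z := by
  simp only [wirtZ, fderiv_fun_mul hg hh, add_apply,
    smul_apply, smul_eq_mul]
  ring

theorem wirtZbar_mul (hg : DifferentiableAt ℝ g z) (hh : DifferentiableAt ℝ h z) :
    wirtZbar (fun w => g w * h w) z = wirtZbar g z * h z + g z * wirtZbar h z := by
  simp only [wirtZbar, fderiv_fun_mul hg hh, add_apply,
    smul_apply, smul_eq_mul]
  ring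

@[simp] theorem wirtZ_const (c : ℂ) : wirtZ (fun _ => c) z = 0 := by simp [wirtZ]

@[simp] theorem wirtZbar_const (c : ℂ) : wirtZbar (fun _ => c) z = 0 := by simp [wirtZbar]

theorem wirtZ_comp {φ : ℂ → ℂ} {φ' : ℂ} (hφ : HasDerivAt φ φ' (g z))
    (hg : DifferentiableAt ℝ g z) : wirtZ (fun w => φ (g w)) z = φ' * wirtZ g z := by
  have h := (hφ.hasFDerivAt.restrictScalars ℝ).comp z hg.hasFDerivAt
  have h' : fderiv ℝ (fun w => φ (g w)) z = _ := h.fderiv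
  simp only [wirtZ, h', ContinuousLinearMap.comp_apply, ContinuousLinearMap.coe_restrictScalars',
    ContinuousLinearMap.toSpanSingleton_apply, smul_eq_mul]
  ring

theorem wirtZbar_comp {φ : ℂ → ℂ} {φ' : ℂ} (hφ : HasDerivAt φ φ' (g z))
    (hg : DifferentiableAt ℝ g z) : wirtZbar (fun w => φ (g w)) z = φ' * wirtZbar g z := by
  have h := (hφ.hasFDerivAt.restrictScalars ℝ).comp z hg.hasFDerivAt
  have h' : fderiv ℝ (fun w => φ (g w)) z = _ := h.fderiv
  simp only [wirtZbar, h', ContinuousLinearMap.comp_apply,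
    ContinuousLinearMap.coe_restrictScalars', ContinuousLinearMap.toSpanSingleton_apply,
    smul_eq_mul]
  ring

theorem wirtZ_const_mul (c : ℂ) (hg : DifferentiableAt ℝ g z) :
    wirtZ (fun w => c * g w) z = c * wirtZ g z := by
  simp [wirtZ_mul (differentiableAt_const c) hg]

theorem wirtZbar_const_mul (c : ℂ) (hg : DifferentiableAt ℝ g z) :
    wirtZbar (fun w => c * g w) z = c * wirtZbar g z := by
  simp [wirtZbar_mul (differentiableAt_const c) hg]

theorem fderiv_conj_apply (hg : DifferentiableAt ℝ g z) (v : ℂ) :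
    fderiv ℝ (fun w => (starRingEnd ℂ) (g w)) z v = (starRingEnd ℂ) (fderiv ℝ g z v) := by
  have h := (Complex.conjCLE.toContinuousLinearMap.hasFDerivAt (x := g z)).comp z hg.hasFDerivAt
  have h' : fderiv ℝ (fun w => (starRingEnd ℂ) (g w)) z = _ := h.fderiv
  rw [h']
  simp

theorem wirtZ_conj (hg : DifferentiableAt ℝ g z) :
    wirtZ (fun w => (starRingEnd ℂ) (g w)) z = (starRingEnd ℂ) (wirtZbar g z) := by
  simp [wirtZ, wirtZbar, fderiv_conj_apply hg, sub_eq_add_neg, Complex.conj_ofNat]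

theorem wirtZbar_conj (hg : DifferentiableAt ℝ g z) :
    wirtZbar (fun w => (starRingEnd ℂ) (g w)) z = (starRingEnd ℂ) (wirtZ g z) := by
  simp [wirtZ, wirtZbar, fderiv_conj_apply hg, sub_eq_add_neg, Complex.conj_ofNat]

theorem wirtZ_ofReal {r : ℂ → ℝ} (hr : DifferentiableAt ℝ (fun w => (r w : ℂ)) z) :
    wirtZ (fun w => (r w : ℂ)) z = (starRingEnd ℂ) (wirtZbar (fun w => (r w : ℂ)) z) := by
  rw [← wirtZ_conj hr]
  simp

theorem contDiff_wirtZ (hg : ContDiff ℝ (⊤ : ℕ∞) g) : ContDiff ℝ (⊤ : ℕ∞) (wirtZ g) := by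
  have h : ContDiff ℝ (⊤ : ℕ∞) (fderiv ℝ g) := hg.fderiv_right (by simp)
  unfold wirtZ
  fun_prop

theorem contDiff_wirtZbar (hg : ContDiff ℝ (⊤ : ℕ∞) g) : ContDiff ℝ (⊤ : ℕ∞) (wirtZbar g) := by
  have h : ContDiff ℝ (⊤ : ℕ∞) (fderiv ℝ g) := hg.fderiv_right (by simp)
  unfold wirtZbar
  fun_prop

theorem wirtZ_wirtZbar_comm (hg : ContDiff ℝ (⊤ : ℕ∞) g) :
    wirtZ (wirtZbar g) z = wirtZbar (wirtZ g) z := by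
  have h : ContDiff ℝ (⊤ : ℕ∞) (fderiv ℝ g) := hg.fderiv_right (by simp)
  have hd : DifferentiableAt ℝ (fderiv ℝ g) z := h.differentiable (by simp) z
  have hs : IsSymmSndFDerivAt ℝ g z :=
    hg.contDiffAt.isSymmSndFDerivAt (by
      rw [minSmoothness_of_isRCLikeNormedField]
      exact WithTop.coe_le_coe.2 le_top)
  have h1 (u v : ℂ) : fderiv ℝ (fun w => fderiv ℝ g w u) z v = fderiv ℝ (fderiv ℝ g) z v u := by
    rw [fderiv_clm_apply hd (by fun_prop)]
    simp
  have hu (u : ℂ) : DifferentiableAt ℝ (fun w => fderiv ℝ g w u) z := by fun_prop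
  have h2 (v : ℂ) : fderiv ℝ (wirtZbar g) z v = (1 / 2 : ℂ) *
      (fderiv ℝ (fderiv ℝ g) z v 1 + Complex.I * fderiv ℝ (fderiv ℝ g) z v Complex.I) := by
    unfold wirtZbar
    rw [fderiv_const_mul ((hu 1).fun_add ((hu I).const_mul I)),
      fderiv_fun_add (hu 1) ((hu I).const_mul I), fderiv_const_mul (hu I)]
    simp [h1, mul_add]
  have h3 (v : ℂ) : fderiv ℝ (wirtZ g) z v = (1 / 2 : ℂ) *
      (fderiv ℝ (fderiv ℝ g) z v 1 - Complex.I * fderiv ℝ (fderiv ℝ g) z v Complex.I) := by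
    unfold wirtZ
    rw [fderiv_const_mul ((hu 1).fun_sub ((hu I).const_mul I)),
      fderiv_fun_sub (hu 1) ((hu I).const_mul I), fderiv_const_mul (hu I)]
    simp [h1]
  have e : wirtZ (wirtZbar g) z = (1 / 2 : ℂ) *
      (fderiv ℝ (wirtZbar g) z 1 - Complex.I * fderiv ℝ (wirtZbar g) z Complex.I) := rfl
  have e' : wirtZbar (wirtZ g) z = (1 / 2 : ℂ) *
      (fderiv ℝ (wirtZ g) z 1 + Complex.I * fderiv ℝ (wirtZ g) z Complex.I) := rfl
  rw [e, e', h2, h2, h3, h3, hs.eq I 1]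
  ring

end Wirtinger

section Pairing

variable {m : ℕ}

theorem pairC_comm (u v : Fin m → ℂ) : pairC u v = pairC v u := by
  simp [pairC, mul_comm]

@[simp] theorem pairC_add_left (u v w : Fin m → ℂ) :
    pairC (u + v) w = pairC u w + pairC v w := by
  simp [pairC, add_mul, Finset.sum_add_distrib]

@[simp] theorem pairC_smul_left (c : ℂ) (u w : Fin m → ℂ) :
    pairC (c • u) w = c * pairC u w := by
  simp [pairC, mul_assoc, Finset.mul_sum]

@[simp] theorem pairC_add_right (u v w : Fin m → ℂ) :
    pairC w (u + v) = pairC w u + pairC w v := by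
  simp [pairC, mul_add, Finset.sum_add_distrib]

@[simp] theorem pairC_smul_right (c : ℂ) (u w : Fin m → ℂ) :
    pairC w (c • u) = c * pairC w u := by
  simp [pairC, mul_left_comm, Finset.mul_sum]

theorem pairC_conjV (u v : Fin m → ℂ) :
    pairC (conjV u) (conjV v) = (starRingEnd ℂ) (pairC u v) := by
  simp [pairC, conjV]

@[simp] theorem conjV_add (u v : Fin m → ℂ) : conjV (u + v) = conjV u + conjV v := by
  ext i; simp [conjV]

@[simp] theorem conjV_smul (c : ℂ) (u : Fin m → ℂ) :
    conjV (c • u) = (starRingEnd ℂ) c • conjV u := by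
  ext i; simp [conjV]

@[simp] theorem conjV_conjV (u : Fin m → ℂ) : conjV (conjV u) = u := by
  ext i; simp [conjV]

@[simp] theorem conjV_Fc (g : ℂ → Fin m → ℝ) (z : ℂ) : conjV (Fc g z) = Fc g z := by
  ext i; simp [conjV, Fc, cV]

variable {u v : ℂ → Fin m → ℂ} {z : ℂ}

theorem wirtZ_pairC (hu : ContDiff ℝ (⊤ : ℕ∞) u) (hv : ContDiff ℝ (⊤ : ℕ∞) v) :
    wirtZ (fun w => pairC (u w) (v w)) z = pairC (WZ u z) (v z) + pairC (u z) (WZ v z) := by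
  have hu' := contDiff_pi.1 hu
  have hv' := contDiff_pi.1 hv
  have h (i : Fin m) := wirtZ_mul ((hu' i).differentiable (by simp) z)
    ((hv' i).differentiable (by simp) z)
  have hd (i : Fin m) : DifferentiableAt ℝ (fun w => u w i * v w i) z :=
    ((hu' i).mul (hv' i)).differentiable (by simp) z
  simp only [pairC, WZ, ← Finset.sum_add_distrib, ← h]
  simp only [wirtZ, fderiv_fun_sum fun i _ => hd i, sum_apply,
    Finset.mul_sum, ← Finset.sum_sub_distrib]

theorem wirtZbar_pairC (hu : ContDiff ℝ (⊤ : ℕ∞) u) (hv : ContDiff ℝ (⊤ : ℕ∞) v) :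
    wirtZbar (fun w => pairC (u w) (v w)) z =
      pairC (WZb u z) (v z) + pairC (u z) (WZb v z) := by
  have hu' := contDiff_pi.1 hu
  have hv' := contDiff_pi.1 hv
  have h (i : Fin m) := wirtZbar_mul ((hu' i).differentiable (by simp) z)
    ((hv' i).differentiable (by simp) z)
  have hd (i : Fin m) : DifferentiableAt ℝ (fun w => u w i * v w i) z :=
    ((hu' i).mul (hv' i)).differentiable (by simp) z
  simp only [pairC, WZb, ← Finset.sum_add_distrib, ← h]
  simp only [wirtZbar, fderiv_fun_sum fun i _ => hd i, sum_apply,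
    Finset.mul_sum, ← Finset.sum_add_distrib]

theorem contDiff_WZ (hu : ContDiff ℝ (⊤ : ℕ∞) u) : ContDiff ℝ (⊤ : ℕ∞) (WZ u) :=
  contDiff_pi.2 fun i => contDiff_wirtZ (contDiff_pi.1 hu i)

theorem contDiff_WZb (hu : ContDiff ℝ (⊤ : ℕ∞) u) : ContDiff ℝ (⊤ : ℕ∞) (WZb u) :=
  contDiff_pi.2 fun i => contDiff_wirtZbar (contDiff_pi.1 hu i)

theorem WZ_WZb_comm (hu : ContDiff ℝ (⊤ : ℕ∞) u) : WZ (WZb u) z = WZb (WZ u) z :=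
  funext fun i => wirtZ_wirtZbar_comm (contDiff_pi.1 hu i)

theorem WZb_conjV (hu : ContDiff ℝ (⊤ : ℕ∞) u) :
    WZb (fun w => conjV (u w)) z = conjV (WZ u z) :=
  funext fun i => wirtZbar_conj ((contDiff_pi.1 hu i).differentiable (by simp) z)

theorem WZ_add (hu : ContDiff ℝ (⊤ : ℕ∞) u) (hv : ContDiff ℝ (⊤ : ℕ∞) v) :
    WZ (fun w => u w + v w) z = WZ u z + WZ v z :=
  funext fun i => wirtZ_add ((contDiff_pi.1 hu i).differentiable (by simp) z)
    ((contDiff_pi.1 hv i).differentiable (by simp) z)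

theorem WZb_add (hu : ContDiff ℝ (⊤ : ℕ∞) u) (hv : ContDiff ℝ (⊤ : ℕ∞) v) :
    WZb (fun w => u w + v w) z = WZb u z + WZb v z :=
  funext fun i => wirtZbar_add ((contDiff_pi.1 hu i).differentiable (by simp) z)
    ((contDiff_pi.1 hv i).differentiable (by simp) z)

theorem WZ_smul {a : ℂ → ℂ} (ha : ContDiff ℝ (⊤ : ℕ∞) a) (hu : ContDiff ℝ (⊤ : ℕ∞) u) :
    WZ (fun w => a w • u w) z = wirtZ a z • u z + a z • WZ u z :=
  funext fun i => wirtZ_mul (ha.differentiable (by simp) z)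
    ((contDiff_pi.1 hu i).differentiable (by simp) z)

theorem WZb_smul {a : ℂ → ℂ} (ha : ContDiff ℝ (⊤ : ℕ∞) a) (hu : ContDiff ℝ (⊤ : ℕ∞) u) :
    WZb (fun w => a w • u w) z = wirtZbar a z • u z + a z • WZb u z :=
  funext fun i => wirtZbar_mul (ha.differentiable (by simp) z)
    ((contDiff_pi.1 hu i).differentiable (by simp) z)

theorem contDiff_Fc {g : ℂ → Fin m → ℝ} (hg : ContDiff ℝ (⊤ : ℕ∞) g) :
    ContDiff ℝ (⊤ : ℕ∞) (Fc g) :=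
  contDiff_pi.2 fun i => Complex.ofRealCLM.contDiff.comp (contDiff_pi.1 hg i)

theorem WZb_Fc {g : ℂ → Fin m → ℝ} (hg : ContDiff ℝ (⊤ : ℕ∞) g) :
    WZb (Fc g) z = conjV (WZ (Fc g) z) := by
  rw [← WZb_conjV (contDiff_Fc hg)]
  simp

theorem WZ_Fc {g : ℂ → Fin m → ℝ} (hg : ContDiff ℝ (⊤ : ℕ∞) g) :
    WZ (Fc g) z = conjV (WZb (Fc g) z) := by
  rw [WZb_Fc hg, conjV_conjV]

theorem pairC_Fc (g h : ℂ → Fin m → ℝ) :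
    pairC (Fc g z) (Fc h z) = ((∑ i, g z i * h z i : ℝ) : ℂ) := by
  simp [pairC, Fc, cV]

end Pairing

theorem eq_sum_pairC_of_dual {n : ℕ} {a b : Fin n → Fin n → ℂ}
    (hab : ∀ i j, pairC (a i) (b j) = if i = j then 1 else 0) (v : Fin n → ℂ) :
    v = ∑ i, pairC v (a i) • b i := by
  have h : (Matrix.of a) * (Matrix.of b).transpose = 1 := by
    ext i j
    simpa [Matrix.mul_apply, Matrix.one_apply, pairC] using hab i j
  have h' := mul_eq_one_comm.1 h
  ext j
  have key := congrArg (fun M => Matrix.mulVec M v j) h'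
  simp only [← Matrix.mulVec_mulVec, Matrix.one_mulVec] at key
  rw [← key]
  simp [Matrix.mulVec, dotProduct, pairC, mul_comm]

section Immersion

variable {m : ℕ} {f : ℂ → Fin m → ℝ} {ρ : ℂ → ℝ}

theorem ofReal_exp_mul_exp_neg (x : ℝ) :
    (Real.exp (2 * x) : ℂ) * (Real.exp (-2 * x) : ℂ) = 1 := by
  rw [← Complex.ofReal_mul, ← Real.exp_add]
  simp

theorem contDiff_ofReal {r : ℂ → ℝ} (hr : ContDiff ℝ (⊤ : ℕ∞) r) :
    ContDiff ℝ (⊤ : ℕ∞) (fun w => (r w : ℂ)) :=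
  Complex.ofRealCLM.contDiff.comp hr

namespace IsConfMinImm

theorem pairC_self (hf : IsConfMinImm f ρ) (z : ℂ) : pairC (Fc f z) (Fc f z) = 1 := by
  rw [pairC_Fc]
  simpa [pow_two] using congrArg (fun x : ℝ => (x : ℂ)) (hf.2.2.1 z)

theorem pairC_WZ_WZb (hf : IsConfMinImm f ρ) (z : ℂ) :
    pairC (WZ (Fc f) z) (WZb (Fc f) z) = (1 / 2 : ℂ) * (Real.exp (2 * ρ z) : ℂ) := by
  rw [WZb_Fc hf.1]
  exact hf.2.2.2.2.1 z

theorem pairC_WZb_WZb (hf : IsConfMinImm f ρ) (z : ℂ) :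
    pairC (WZb (Fc f) z) (WZb (Fc f) z) = 0 := by
  rw [WZb_Fc hf.1, pairC_conjV, hf.2.2.2.1 z, map_zero]

theorem pairC_self_WZ (hf : IsConfMinImm f ρ) (z : ℂ) :
    pairC (Fc f z) (WZ (Fc f) z) = 0 := by
  have h := wirtZ_pairC (z := z) (contDiff_Fc hf.1) (contDiff_Fc hf.1)
  simp only [hf.pairC_self, wirtZ_const] at h
  rw [pairC_comm (WZ _ _)] at h
  linear_combination -(1 / 2 : ℂ) * h

theorem pairC_self_WZb (hf : IsConfMinImm f ρ) (z : ℂ) :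
    pairC (Fc f z) (WZb (Fc f) z) = 0 := by
  have h := pairC_conjV (Fc f z) (WZ (Fc f) z)
  rwa [hf.pairC_self_WZ, conjV_Fc, ← WZb_Fc hf.1, map_zero] at h

theorem WZb_WZ (hf : IsConfMinImm f ρ) :
    WZb (WZ (Fc f)) = fun z => (-(1 / 2 : ℂ) * (Real.exp (2 * ρ z) : ℂ)) • Fc f z := by
  ext z i
  simpa using hf.2.2.2.2.2 z i

theorem contDiff_Hopf (hf : IsConfMinImm f ρ) : ContDiff ℝ (⊤ : ℕ∞) (Hopf f ρ) := by
  have hF := contDiff_WZ (contDiff_Fc hf.1)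
  have hFF := contDiff_pi.1 (contDiff_WZ hF)
  have hFi := contDiff_pi.1 hF
  have hρ : ContDiff ℝ (⊤ : ℕ∞) (dZ ρ) := contDiff_wirtZ (contDiff_ofReal hf.2.1)
  exact contDiff_pi.2 fun i => (hFF i).sub ((contDiff_const.mul hρ).mul (hFi i))

theorem WZ_WZ (z : ℂ) :
    WZ (WZ (Fc f)) z = Hopf f ρ z + (2 * dZ ρ z) • WZ (Fc f) z := by
  ext i
  simp [Hopf]

/-- The Codazzi equation: `Ω_z̄` is tangent to the cone over `f`. -/
theorem exists_WZb_Hopf (hf : IsConfMinImm f ρ) (z : ℂ) :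
    ∃ α β : ℂ, WZb (Hopf f ρ) z = α • Fc f z + β • WZ (Fc f) z := by
  have hF := contDiff_WZ (contDiff_Fc hf.1)
  have hρ : ContDiff ℝ (⊤ : ℕ∞) (fun w => 2 * dZ ρ w) :=
    contDiff_const.mul (contDiff_wirtZ (contDiff_ofReal hf.2.1))
  have he : ContDiff ℝ (⊤ : ℕ∞) (fun w => -(1 / 2 : ℂ) * (Real.exp (2 * ρ w) : ℂ)) :=
    contDiff_const.mul (contDiff_ofReal (contDiff_const.mul hf.2.1).exp)
  have h1 : WZb (WZ (WZ (Fc f))) z =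
      WZb (Hopf f ρ) z + WZb (fun w => (2 * dZ ρ w) • WZ (Fc f) w) z :=
    (congrArg (fun u => WZb u z) (funext WZ_WZ)).trans (WZb_add hf.contDiff_Hopf (hρ.smul hF))
  rw [WZb_smul hρ hF, ← WZ_WZb_comm hF, hf.WZb_WZ,
    WZ_smul he (contDiff_Fc hf.1)] at h1
  refine ⟨wirtZ (fun w => -(1 / 2 : ℂ) * (Real.exp (2 * ρ w) : ℂ)) z
    - 2 * dZ ρ z * (-(1 / 2 : ℂ) * (Real.exp (2 * ρ z) : ℂ)),
    -(1 / 2 : ℂ) * (Real.exp (2 * ρ z) : ℂ) - wirtZbar (fun w => 2 * dZ ρ w) z, ?_⟩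
  ext i
  have h2 := congrFun h1 i
  simp only [Pi.add_apply, Pi.smul_apply, smul_eq_mul] at h2 ⊢
  linear_combination -h2

end IsConfMinImm

theorem pairC_WZb_of_pairC_eq_const {u v : ℂ → Fin m → ℂ} (hu : ContDiff ℝ (⊤ : ℕ∞) u)
    (hv : ContDiff ℝ (⊤ : ℕ∞) v) {c : ℂ} (h : ∀ z, pairC (u z) (v z) = c) (z : ℂ) :
    pairC (WZb u z) (v z) = -pairC (u z) (WZb v z) := by
  have h1 := wirtZbar_pairC (z := z) hu hv
  simp only [h, wirtZbar_const] at h1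
  linear_combination -h1

end Immersion

namespace S4Frame

variable {f : ℂ → Fin 5 → ℝ} {ρ : ℂ → ℝ} {ψ₃ ψ₄ : ℂ → Fin 5 → ℝ} {θ : ℂ → ℝ}

theorem pairC_three (h : S4Frame f ρ ψ₃ ψ₄ θ) (z : ℂ) : pairC (Fc ψ₃ z) (Fc ψ₃ z) = 1 := by
  rw [pairC_Fc]
  simpa [pow_two] using congrArg (fun x : ℝ => (x : ℂ)) (h.2.2.2.2.2.1 z)

theorem pairC_four (h : S4Frame f ρ ψ₃ ψ₄ θ) (z : ℂ) : pairC (Fc ψ₄ z) (Fc ψ₄ z) = 1 := by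
  rw [pairC_Fc]
  simpa [pow_two] using congrArg (fun x : ℝ => (x : ℂ)) (h.2.2.2.2.2.2.1 z)

theorem pairC_three_four (h : S4Frame f ρ ψ₃ ψ₄ θ) (z : ℂ) :
    pairC (Fc ψ₃ z) (Fc ψ₄ z) = 0 := by
  rw [pairC_Fc, h.2.2.2.2.2.2.2.1 z, Complex.ofReal_zero]

theorem pairC_four_three (h : S4Frame f ρ ψ₃ ψ₄ θ) (z : ℂ) :
    pairC (Fc ψ₄ z) (Fc ψ₃ z) = 0 := by
  rw [pairC_comm, h.pairC_three_four]

theorem Hopf_eq (h : S4Frame f ρ ψ₃ ψ₄ θ) :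
    Hopf f ρ = fun z => Complex.cosh (θ z) • Fc ψ₃ z + (I * Complex.sinh (θ z)) • Fc ψ₄ z := by
  obtain ⟨-, -, -, -, -, -, -, -, -, hre, him⟩ := h
  ext z i
  rw [← Complex.re_add_im (Hopf f ρ z i), hre, him]
  simp [Fc, cV]
  ring

theorem conjV_Hopf (h : S4Frame f ρ ψ₃ ψ₄ θ) (z : ℂ) :
    conjV (Hopf f ρ z) =
      Complex.cosh (θ z) • Fc ψ₃ z + (-(I * Complex.sinh (θ z))) • Fc ψ₄ z := by
  simp [h.Hopf_eq, ← Complex.cosh_conj, ← Complex.sinh_conj]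

theorem expansion (hf : IsConfMinImm f ρ) (h : S4Frame f ρ ψ₃ ψ₄ θ) (z : ℂ) (v : Fin 5 → ℂ) :
    v = pairC v (Fc f z) • Fc f z
      + (2 * (Real.exp (-2 * ρ z) : ℂ) * pairC v (WZ (Fc f) z)) • WZb (Fc f) z
      + (2 * (Real.exp (-2 * ρ z) : ℂ) * pairC v (WZb (Fc f) z)) • WZ (Fc f) z
      + pairC v (Fc ψ₃ z) • Fc ψ₃ z + pairC v (Fc ψ₄ z) • Fc ψ₄ z := by
  obtain ⟨h3f, h3F, h3G⟩ := h.2.2.2.1 z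
  obtain ⟨h4f, h4F, h4G⟩ := h.2.2.2.2.1 z
  have hE := ofReal_exp_mul_exp_neg (ρ z)
  have h33 := h.pairC_three z
  have h44 := h.pairC_four z
  have h34 := h.pairC_three_four z
  have h43 := h.pairC_four_three z
  have hff := hf.pairC_self z
  have hfF := hf.pairC_self_WZ z
  have hfG := hf.pairC_self_WZb z
  have hFF := hf.2.2.2.1 z
  have hGG := hf.pairC_WZb_WZb z
  have hFG := hf.pairC_WZ_WZb z
  have hf3 := (pairC_comm _ _).trans h3f
  have hF3 := (pairC_comm _ _).trans h3F
  have hG3 := (pairC_comm _ _).trans h3G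
  have hf4 := (pairC_comm _ _).trans h4f
  have hF4 := (pairC_comm _ _).trans h4F
  have hG4 := (pairC_comm _ _).trans h4G
  have hFf := (pairC_comm _ _).trans hfF
  have hGf := (pairC_comm _ _).trans hfG
  have hGF := (pairC_comm _ _).trans hFG
  have hE' : 2 * (Real.exp (-2 * ρ z) : ℂ) * ((1 / 2 : ℂ) * (Real.exp (2 * ρ z) : ℂ)) = 1 := by
    linear_combination hE
  have key := eq_sum_pairC_of_dual
    (a := ![Fc f z, WZ (Fc f) z, WZb (Fc f) z, Fc ψ₃ z, Fc ψ₄ z])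
    (b := ![Fc f z, (2 * (Real.exp (-2 * ρ z) : ℂ)) • WZb (Fc f) z,
      (2 * (Real.exp (-2 * ρ z) : ℂ)) • WZ (Fc f) z, Fc ψ₃ z, Fc ψ₄ z]) (by
    intro i j
    fin_cases i <;> fin_cases j <;>
      simp only [Fin.zero_eta, Fin.mk_one, Fin.reduceFinMk, Matrix.cons_val, pairC_smul_right,
        h3f, h3F, h3G, h4f, h4F, h4G, h33, h44, h34, h43, hff, hfF, hfG, hFF, hGG, hFG, hf3,
        hF3, hG3, hf4, hF4, hG4, hFf, hGf, hGF, hE', mul_zero] <;>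
      simp) v
  rw [Fin.sum_univ_five] at key
  simp only [Matrix.cons_val] at key
  nth_rewrite 1 [key]
  simp only [smul_smul]
  congr 4 <;> ring_nf

theorem smooth_theta (h : S4Frame f ρ ψ₃ ψ₄ θ) : ContDiff ℝ (⊤ : ℕ∞) (fun w => (θ w : ℂ)) :=
  contDiff_ofReal h.2.2.1

theorem smooth_cosh (h : S4Frame f ρ ψ₃ ψ₄ θ) :
    ContDiff ℝ (⊤ : ℕ∞) (fun w => Complex.cosh (θ w : ℂ)) := by
  have hc : ContDiff ℝ (⊤ : ℕ∞) Complex.cosh := Complex.contDiff_cosh.restrict_scalars ℝ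
  exact hc.comp h.smooth_theta

theorem smooth_sinh (h : S4Frame f ρ ψ₃ ψ₄ θ) :
    ContDiff ℝ (⊤ : ℕ∞) (fun w => Complex.sinh (θ w : ℂ)) := by
  have hc : ContDiff ℝ (⊤ : ℕ∞) Complex.sinh := Complex.contDiff_sinh.restrict_scalars ℝ
  exact hc.comp h.smooth_theta

theorem differentiable_theta (h : S4Frame f ρ ψ₃ ψ₄ θ) (z : ℂ) :
    DifferentiableAt ℝ (fun w => (θ w : ℂ)) z :=
  h.smooth_theta.differentiable (by simp) z

theorem wirtZbar_theta (h : S4Frame f ρ ψ₃ ψ₄ θ) (z : ℂ) :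
    wirtZbar (fun w => (θ w : ℂ)) z = (starRingEnd ℂ) (dZ θ z) := by
  rw [dZ, wirtZ_ofReal (h.differentiable_theta z), Complex.conj_conj]

theorem wirtZ_cosh (h : S4Frame f ρ ψ₃ ψ₄ θ) (z : ℂ) :
    wirtZ (fun w => Complex.cosh (θ w : ℂ)) z = Complex.sinh (θ z) * dZ θ z :=
  wirtZ_comp (Complex.hasDerivAt_cosh _) (h.differentiable_theta z)

theorem wirtZ_sinh (h : S4Frame f ρ ψ₃ ψ₄ θ) (z : ℂ) :
    wirtZ (fun w => Complex.sinh (θ w : ℂ)) z = Complex.cosh (θ z) * dZ θ z :=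
  wirtZ_comp (Complex.hasDerivAt_sinh _) (h.differentiable_theta z)

theorem wirtZbar_cosh (h : S4Frame f ρ ψ₃ ψ₄ θ) (z : ℂ) :
    wirtZbar (fun w => Complex.cosh (θ w : ℂ)) z =
      Complex.sinh (θ z) * wirtZbar (fun w => (θ w : ℂ)) z :=
  wirtZbar_comp (Complex.hasDerivAt_cosh _) (h.differentiable_theta z)

theorem wirtZbar_sinh (h : S4Frame f ρ ψ₃ ψ₄ θ) (z : ℂ) :
    wirtZbar (fun w => Complex.sinh (θ w : ℂ)) z =
      Complex.cosh (θ z) * wirtZbar (fun w => (θ w : ℂ)) z :=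
  wirtZbar_comp (Complex.hasDerivAt_sinh _) (h.differentiable_theta z)

theorem wirtZ_conj_theta (h : S4Frame f ρ ψ₃ ψ₄ θ) (z : ℂ) :
    (starRingEnd ℂ) (wirtZbar (fun w => (θ w : ℂ)) z) = dZ θ z := by
  rw [h.wirtZbar_theta, Complex.conj_conj]

theorem pairC_WZb_Hopf_four (hf : IsConfMinImm f ρ) (h : S4Frame f ρ ψ₃ ψ₄ θ) (z : ℂ) :
    pairC (WZb (Hopf f ρ) z) (Fc ψ₄ z) = 0 := by
  obtain ⟨α, β, hαβ⟩ := hf.exists_WZb_Hopf z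
  obtain ⟨h4f, h4F, -⟩ := h.2.2.2.2.1 z
  rw [hαβ, pairC_comm]
  simp [h4f, h4F]

/-- The connection form of the normal bundle in the adapted frame is `-i θ_z̄`. -/
theorem pairC_WZb_three_four (hf : IsConfMinImm f ρ) (h : S4Frame f ρ ψ₃ ψ₄ θ) (z : ℂ) :
    pairC (WZb (Fc ψ₃) z) (Fc ψ₄ z) = -(I * wirtZbar (fun w => (θ w : ℂ)) z) := by
  have h3 := contDiff_Fc h.1
  have h4 := contDiff_Fc h.2.1
  have hIs : ContDiff ℝ (⊤ : ℕ∞) (fun w => I * Complex.sinh (θ w : ℂ)) :=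
    contDiff_const.mul h.smooth_sinh
  have hc : Complex.cosh (θ z : ℂ) ≠ 0 := by
    rw [← Complex.ofReal_cosh]
    exact_mod_cast (Real.cosh_pos (θ z)).ne'
  have h44 := pairC_WZb_of_pairC_eq_const h4 h4 h.pairC_four z
  rw [pairC_comm (Fc ψ₄ z)] at h44
  have h44' : pairC (WZb (Fc ψ₄) z) (Fc ψ₄ z) = 0 := by linear_combination (1 / 2 : ℂ) * h44
  have key := h.pairC_WZb_Hopf_four hf z
  have hΩ : WZb (Hopf f ρ) z =
      WZb (fun w => Complex.cosh (θ w : ℂ) • Fc ψ₃ w) z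
        + WZb (fun w => (I * Complex.sinh (θ w : ℂ)) • Fc ψ₄ w) z :=
    (congrArg (fun u => WZb u z) h.Hopf_eq).trans
      (WZb_add (h.smooth_cosh.smul h3) (hIs.smul h4))
  rw [hΩ, WZb_smul h.smooth_cosh h3, WZb_smul hIs h4,
    wirtZbar_const_mul _ (h.smooth_sinh.differentiable (by simp) z), h.wirtZbar_sinh] at key
  simp only [pairC_add_left, pairC_smul_left, h44', h.pairC_four, h.pairC_three_four] at key
  apply mul_left_cancel₀ hc
  linear_combination key

theorem pairC_Hopf_three (h : S4Frame f ρ ψ₃ ψ₄ θ) (z : ℂ) :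
    pairC (Fc ψ₃ z) (Hopf f ρ z) = Complex.cosh (θ z) := by
  simp [h.Hopf_eq, h.pairC_three, h.pairC_three_four]

theorem pairC_Hopf_four (h : S4Frame f ρ ψ₃ ψ₄ θ) (z : ℂ) :
    pairC (Fc ψ₄ z) (Hopf f ρ z) = I * Complex.sinh (θ z) := by
  simp [h.Hopf_eq, h.pairC_four, h.pairC_four_three]

theorem pairC_conjV_Hopf_three (h : S4Frame f ρ ψ₃ ψ₄ θ) (z : ℂ) :
    pairC (Fc ψ₃ z) (conjV (Hopf f ρ z)) = Complex.cosh (θ z) := by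
  rw [h.conjV_Hopf, pairC_add_right, pairC_smul_right, pairC_smul_right, h.pairC_three,
    h.pairC_three_four]
  ring

theorem pairC_conjV_Hopf_four (h : S4Frame f ρ ψ₃ ψ₄ θ) (z : ℂ) :
    pairC (Fc ψ₄ z) (conjV (Hopf f ρ z)) = -(I * Complex.sinh (θ z)) := by
  rw [h.conjV_Hopf, pairC_add_right, pairC_smul_right, pairC_smul_right, h.pairC_four,
    h.pairC_four_three]
  ring

end S4Frame

namespace IsConfMinImm

variable {m : ℕ} {f : ℂ → Fin m → ℝ} {ρ : ℂ → ℝ}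

theorem WZb_WZb (hf : IsConfMinImm f ρ) (z : ℂ) :
    WZb (WZb (Fc f)) z =
      conjV (Hopf f ρ z) + (starRingEnd ℂ) (2 * dZ ρ z) • WZb (Fc f) z := by
  have h : WZb (Fc f) = fun w => conjV (WZ (Fc f) w) := funext fun w => WZb_Fc hf.1
  rw [h, WZb_conjV (contDiff_WZ (contDiff_Fc hf.1)), WZ_WZ (ρ := ρ), conjV_add, conjV_smul]

variable {ψ : ℂ → Fin m → ℂ}

theorem pairC_WZb_self (hf : IsConfMinImm f ρ) (hs : ContDiff ℝ (⊤ : ℕ∞) ψ)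
    (hψ : IsNormalField f ψ) (z : ℂ) : pairC (WZb ψ z) (Fc f z) = 0 := by
  rw [pairC_WZb_of_pairC_eq_const hs (contDiff_Fc hf.1) (fun w => (hψ w).1), (hψ z).2.2, neg_zero]

theorem pairC_WZb_WZ (hf : IsConfMinImm f ρ) (hs : ContDiff ℝ (⊤ : ℕ∞) ψ)
    (hψ : IsNormalField f ψ) (z : ℂ) : pairC (WZb ψ z) (WZ (Fc f) z) = 0 := by
  rw [pairC_WZb_of_pairC_eq_const hs (contDiff_WZ (contDiff_Fc hf.1)) (fun w => (hψ w).2.1),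
    hf.WZb_WZ, pairC_smul_right, (hψ z).1, mul_zero, neg_zero]

theorem pairC_WZb_WZb_normal (hf : IsConfMinImm f ρ) (hs : ContDiff ℝ (⊤ : ℕ∞) ψ)
    (hψ : IsNormalField f ψ) (z : ℂ) :
    pairC (WZb ψ z) (WZb (Fc f) z) = -pairC (ψ z) (conjV (Hopf f ρ z)) := by
  rw [pairC_WZb_of_pairC_eq_const hs (contDiff_WZb (contDiff_Fc hf.1)) (fun w => (hψ w).2.2),
    hf.WZb_WZb, pairC_add_right, pairC_smul_right, (hψ z).2.2, mul_zero, add_zero]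

end IsConfMinImm

namespace S4Frame

variable {f : ℂ → Fin 5 → ℝ} {ρ : ℂ → ℝ} {ψ₃ ψ₄ : ℂ → Fin 5 → ℝ} {θ : ℂ → ℝ}

theorem WZb_three (hf : IsConfMinImm f ρ) (h : S4Frame f ρ ψ₃ ψ₄ θ) (z : ℂ) :
    WZb (Fc ψ₃) z = (-(I * wirtZbar (fun w => (θ w : ℂ)) z)) • Fc ψ₄ z
      + (-(2 * (Real.exp (-2 * ρ z) : ℂ) * Complex.cosh (θ z))) • WZ (Fc f) z := by
  have h3 := contDiff_Fc h.1
  have h33 := pairC_WZb_of_pairC_eq_const h3 h3 h.pairC_three z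
  rw [pairC_comm (Fc ψ₃ z)] at h33
  have h33' : pairC (WZb (Fc ψ₃) z) (Fc ψ₃ z) = 0 := by linear_combination (1 / 2 : ℂ) * h33
  have key := h.expansion hf z (WZb (Fc ψ₃) z)
  rw [hf.pairC_WZb_self h3 h.2.2.2.1, hf.pairC_WZb_WZ h3 h.2.2.2.1,
    hf.pairC_WZb_WZb_normal h3 h.2.2.2.1, h.pairC_conjV_Hopf_three, h33',
    h.pairC_WZb_three_four hf] at key
  rw [key]
  module

theorem pairC_WZb_four_three (hf : IsConfMinImm f ρ) (h : S4Frame f ρ ψ₃ ψ₄ θ) (z : ℂ) :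
    pairC (WZb (Fc ψ₄) z) (Fc ψ₃ z) = I * wirtZbar (fun w => (θ w : ℂ)) z := by
  rw [pairC_WZb_of_pairC_eq_const (contDiff_Fc h.2.1) (contDiff_Fc h.1) h.pairC_four_three z,
    pairC_comm, h.pairC_WZb_three_four hf, neg_neg]

theorem WZb_four (hf : IsConfMinImm f ρ) (h : S4Frame f ρ ψ₃ ψ₄ θ) (z : ℂ) :
    WZb (Fc ψ₄) z = (I * wirtZbar (fun w => (θ w : ℂ)) z) • Fc ψ₃ z
      + (2 * (Real.exp (-2 * ρ z) : ℂ) * (I * Complex.sinh (θ z))) • WZ (Fc f) z := by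
  have h4 := contDiff_Fc h.2.1
  have h44 := pairC_WZb_of_pairC_eq_const h4 h4 h.pairC_four z
  rw [pairC_comm (Fc ψ₄ z)] at h44
  have h44' : pairC (WZb (Fc ψ₄) z) (Fc ψ₄ z) = 0 := by linear_combination (1 / 2 : ℂ) * h44
  have key := h.expansion hf z (WZb (Fc ψ₄) z)
  rw [hf.pairC_WZb_self h4 h.2.2.2.2.1, hf.pairC_WZb_WZ h4 h.2.2.2.2.1,
    hf.pairC_WZb_WZb_normal h4 h.2.2.2.2.1, h.pairC_conjV_Hopf_four, h44',
    h.pairC_WZb_four_three hf] at key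
  rw [key]
  module

theorem WZ_three (hf : IsConfMinImm f ρ) (h : S4Frame f ρ ψ₃ ψ₄ θ) (z : ℂ) :
    WZ (Fc ψ₃) z = (I * dZ θ z) • Fc ψ₄ z
      + (-(2 * (Real.exp (-2 * ρ z) : ℂ) * Complex.cosh (θ z))) • WZb (Fc f) z := by
  rw [WZ_Fc h.1, h.WZb_three hf, WZb_Fc hf.1]
  simp only [conjV_add, conjV_smul, conjV_Fc, map_neg, map_mul, Complex.conj_I,
    Complex.conj_ofReal, Complex.conj_ofNat, ← Complex.cosh_conj, h.wirtZ_conj_theta]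
  simp

theorem WZ_four (hf : IsConfMinImm f ρ) (h : S4Frame f ρ ψ₃ ψ₄ θ) (z : ℂ) :
    WZ (Fc ψ₄) z = (-(I * dZ θ z)) • Fc ψ₃ z
      + (-(2 * (Real.exp (-2 * ρ z) : ℂ) * (I * Complex.sinh (θ z)))) • WZb (Fc f) z := by
  rw [WZ_Fc h.2.1, h.WZb_four hf, WZb_Fc hf.1]
  simp only [conjV_add, conjV_smul, conjV_Fc, map_mul, Complex.conj_I,
    Complex.conj_ofReal, Complex.conj_ofNat, ← Complex.sinh_conj, h.wirtZ_conj_theta]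
  simp

theorem pairC_WZ_four_three (hf : IsConfMinImm f ρ) (h : S4Frame f ρ ψ₃ ψ₄ θ) (z : ℂ) :
    pairC (WZ (Fc ψ₄) z) (Fc ψ₃ z) = -I * dZ θ z := by
  have h3G := (pairC_comm _ _).trans (h.2.2.2.1 z).2.2
  rw [h.WZ_four hf, pairC_add_left, pairC_smul_left, pairC_smul_left, h.pairC_three, h3G]
  ring

/-- The Ricci equation in the adapted frame. -/
theorem ricci (hf : IsConfMinImm f ρ) (h : S4Frame f ρ ψ₃ ψ₄ θ) (z : ℂ) :
    wirtZ (wirtZbar (fun w => (θ w : ℂ))) z =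
      -2 * (Real.exp (-2 * ρ z) : ℂ) * Complex.sinh (θ z) * Complex.cosh (θ z) := by
  have h3 := contDiff_Fc h.1
  have h4 := contDiff_Fc h.2.1
  have h1 := wirtZ_pairC (z := z) (contDiff_WZb h4) h3
  have h2 := wirtZbar_pairC (z := z) (contDiff_WZ h4) h3
  have hd : DifferentiableAt ℝ (dZ θ) z :=
    (contDiff_wirtZ h.smooth_theta).differentiable (by simp) z
  have hdz : wirtZbar (dZ θ) z = wirtZ (wirtZbar (fun w => (θ w : ℂ))) z :=
    (wirtZ_wirtZbar_comm h.smooth_theta).symm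
  simp only [h.pairC_WZb_four_three hf] at h1
  simp only [h.pairC_WZ_four_three hf] at h2
  rw [wirtZ_const_mul _ ((contDiff_wirtZbar h.smooth_theta).differentiable (by simp) z),
    WZ_WZb_comm h4, h.WZb_four hf, h.WZ_three hf] at h1
  rw [wirtZbar_const_mul _ hd, hdz, h.WZ_four hf, h.WZb_three hf] at h2
  obtain ⟨h3f, h3F, h3G⟩ := h.2.2.2.1 z
  obtain ⟨h4f, h4F, h4G⟩ := h.2.2.2.2.1 z
  have hFG := hf.pairC_WZ_WZb z
  have hF4 := (pairC_comm _ _).trans h4F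
  have hG4 := (pairC_comm _ _).trans h4G
  have hGF := (pairC_comm _ _).trans hFG
  simp only [pairC_add_left, pairC_smul_left, pairC_add_right, pairC_smul_right,
    h.pairC_three_four, h3F, h3G, hF4, hG4, hFG, hGF] at h1 h2
  have hE := ofReal_exp_mul_exp_neg (ρ z)
  apply mul_left_cancel₀ (mul_ne_zero two_ne_zero Complex.I_ne_zero)
  linear_combination h1 - h2 - 4 * I * (Real.exp (-2 * ρ z) : ℂ) * Complex.sinh (θ z) *
    Complex.cosh (θ z) * hE

variable {a b : ℂ → ℂ}

theorem NZ_frame (hf : IsConfMinImm f ρ) (h : S4Frame f ρ ψ₃ ψ₄ θ)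
    (ha : ContDiff ℝ (⊤ : ℕ∞) a) (hb : ContDiff ℝ (⊤ : ℕ∞) b) (z : ℂ) :
    NZ f ρ (fun w => a w • Fc ψ₃ w + b w • Fc ψ₄ w) z =
      (wirtZ a z - I * dZ θ z * b z) • Fc ψ₃ z + (wirtZ b z + I * dZ θ z * a z) • Fc ψ₄ z := by
  have h3 := contDiff_Fc h.1
  have h4 := contDiff_Fc h.2.1
  have e : NZ f ρ (fun w => a w • Fc ψ₃ w + b w • Fc ψ₄ w) z =
    WZ (fun w => a w • Fc ψ₃ w + b w • Fc ψ₄ w) z + (2 * (Real.exp (-2 * ρ z) : ℂ) *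
      pairC (a z • Fc ψ₃ z + b z • Fc ψ₄ z) (Hopf f ρ z)) • WZb (Fc f) z := rfl
  rw [e, WZ_add (ha.fun_smul h3) (hb.fun_smul h4), WZ_smul ha h3, WZ_smul hb h4, pairC_add_left,
    pairC_smul_left, pairC_smul_left, h.pairC_Hopf_three, h.pairC_Hopf_four, h.WZ_three hf,
    h.WZ_four hf]
  module

theorem NZb_frame (hf : IsConfMinImm f ρ) (h : S4Frame f ρ ψ₃ ψ₄ θ)
    (ha : ContDiff ℝ (⊤ : ℕ∞) a) (hb : ContDiff ℝ (⊤ : ℕ∞) b) (z : ℂ) :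
    NZb f ρ (fun w => a w • Fc ψ₃ w + b w • Fc ψ₄ w) z =
      (wirtZbar a z + I * wirtZbar (fun w => (θ w : ℂ)) z * b z) • Fc ψ₃ z
        + (wirtZbar b z - I * wirtZbar (fun w => (θ w : ℂ)) z * a z) • Fc ψ₄ z := by
  have h3 := contDiff_Fc h.1
  have h4 := contDiff_Fc h.2.1
  have e : NZb f ρ (fun w => a w • Fc ψ₃ w + b w • Fc ψ₄ w) z =
    WZb (fun w => a w • Fc ψ₃ w + b w • Fc ψ₄ w) z + (2 * (Real.exp (-2 * ρ z) : ℂ) *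
      pairC (a z • Fc ψ₃ z + b z • Fc ψ₄ z) (conjV (Hopf f ρ z))) • WZ (Fc f) z := rfl
  rw [e, WZb_add (ha.fun_smul h3) (hb.fun_smul h4), WZb_smul ha h3, WZb_smul hb h4, pairC_add_left,
    pairC_smul_left, pairC_smul_left, h.pairC_conjV_Hopf_three, h.pairC_conjV_Hopf_four,
    h.WZb_three hf, h.WZb_four hf]
  module

theorem NZ_NZb_frame (hf : IsConfMinImm f ρ) (h : S4Frame f ρ ψ₃ ψ₄ θ) (p q z : ℂ) :
    NZ f ρ (NZb f ρ (fun w => (p * Complex.sinh (θ w)) • Fc ψ₃ w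
        + (q * Complex.cosh (θ w)) • Fc ψ₄ w)) z =
      ((p + I * q) * wirtZ (wirtZbar (fun w => (θ w : ℂ))) z) •
        (Complex.cosh (θ z) • Fc ψ₃ z - (I * Complex.sinh (θ z)) • Fc ψ₄ z) := by
  have hs := h.smooth_sinh
  have hc := h.smooth_cosh
  have hT := contDiff_wirtZbar h.smooth_theta
  have ds := hs.differentiable (by simp) z
  have dc := hc.differentiable (by simp) z
  have dT := hT.differentiable (by simp) z
  have e : NZb f ρ (fun w => (p * Complex.sinh (θ w)) • Fc ψ₃ w
        + (q * Complex.cosh (θ w)) • Fc ψ₄ w) =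
      fun w => ((p + I * q) * (wirtZbar (fun w => (θ w : ℂ)) w * Complex.cosh (θ w))) • Fc ψ₃ w
        + ((-I * (p + I * q)) *
          (wirtZbar (fun w => (θ w : ℂ)) w * Complex.sinh (θ w))) • Fc ψ₄ w := by
    funext w
    rw [h.NZb_frame hf (contDiff_const.mul hs) (contDiff_const.mul hc),
      wirtZbar_const_mul _ (hs.differentiable (by simp) w),
      wirtZbar_const_mul _ (hc.differentiable (by simp) w), h.wirtZbar_sinh, h.wirtZbar_cosh]
    congr 2
    · ring
    · linear_combination
        (q * Complex.sinh (θ w) * wirtZbar (fun w => (θ w : ℂ)) w) * Complex.I_sq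
  rw [e, h.NZ_frame hf (contDiff_const.mul (hT.mul hc)) (contDiff_const.mul (hT.mul hs)),
    wirtZ_const_mul _ (dT.fun_mul dc), wirtZ_const_mul _ (dT.fun_mul ds), wirtZ_mul dT dc,
    wirtZ_mul dT ds, h.wirtZ_sinh, h.wirtZ_cosh]
  ext i
  simp only [Pi.add_apply, Pi.sub_apply, Pi.smul_apply, smul_eq_mul]
  linear_combination ((p + I * q) * dZ θ z * wirtZbar (fun w => (θ w : ℂ)) z *
    Complex.sinh (θ z) * Fc ψ₃ z i) * Complex.I_sq

theorem NZb_NZ_frame (hf : IsConfMinImm f ρ) (h : S4Frame f ρ ψ₃ ψ₄ θ) (p q z : ℂ) :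
    NZb f ρ (NZ f ρ (fun w => (p * Complex.sinh (θ w)) • Fc ψ₃ w
        + (q * Complex.cosh (θ w)) • Fc ψ₄ w)) z =
      ((p - I * q) * wirtZ (wirtZbar (fun w => (θ w : ℂ))) z) •
        (Complex.cosh (θ z) • Fc ψ₃ z + (I * Complex.sinh (θ z)) • Fc ψ₄ z) := by
  have hs := h.smooth_sinh
  have hc := h.smooth_cosh
  have ht : ContDiff ℝ (⊤ : ℕ∞) (dZ θ) := contDiff_wirtZ h.smooth_theta
  have ds := hs.differentiable (by simp) z
  have dc := hc.differentiable (by simp) z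
  have dt := ht.differentiable (by simp) z
  have hdz : wirtZbar (dZ θ) z = wirtZ (wirtZbar (fun w => (θ w : ℂ))) z :=
    (wirtZ_wirtZbar_comm h.smooth_theta).symm
  have e : NZ f ρ (fun w => (p * Complex.sinh (θ w)) • Fc ψ₃ w
        + (q * Complex.cosh (θ w)) • Fc ψ₄ w) =
      fun w => ((p - I * q) * (dZ θ w * Complex.cosh (θ w))) • Fc ψ₃ w
        + ((I * (p - I * q)) * (dZ θ w * Complex.sinh (θ w))) • Fc ψ₄ w := by
    funext w
    rw [h.NZ_frame hf (contDiff_const.mul hs) (contDiff_const.mul hc),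
      wirtZ_const_mul _ (hs.differentiable (by simp) w),
      wirtZ_const_mul _ (hc.differentiable (by simp) w), h.wirtZ_sinh, h.wirtZ_cosh]
    congr 2
    · ring
    · linear_combination (q * Complex.sinh (θ w) * dZ θ w) * Complex.I_sq
  rw [e, h.NZb_frame hf (contDiff_const.mul (ht.mul hc)) (contDiff_const.mul (ht.mul hs)),
    wirtZbar_const_mul _ (dt.fun_mul dc), wirtZbar_const_mul _ (dt.fun_mul ds),
    wirtZbar_mul dt dc, wirtZbar_mul dt ds, h.wirtZbar_sinh, h.wirtZbar_cosh, hdz]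
  ext i
  simp only [Pi.add_apply, Pi.smul_apply, smul_eq_mul]
  linear_combination ((p - I * q) * dZ θ z * wirtZbar (fun w => (θ w : ℂ)) z *
    Complex.sinh (θ z) * Fc ψ₃ z i) * Complex.I_sq

theorem Jacobi_rotated (hf : IsConfMinImm f ρ) (h : S4Frame f ρ ψ₃ ψ₄ θ) (p q z : ℂ) :
    Jacobi f ρ (fun w => (p * Complex.sinh (θ w)) • Fc ψ₃ w
        + (q * Complex.cosh (θ w)) • Fc ψ₄ w) z =
      (2 : ℂ) • ((p * Complex.sinh (θ z)) • Fc ψ₃ z + (q * Complex.cosh (θ z)) • Fc ψ₄ z) := by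
  have hE : (Real.exp (-4 * ρ z) : ℂ) = (Real.exp (-2 * ρ z) : ℂ) ^ 2 := by
    rw [← Complex.ofReal_pow, ← Real.exp_nat_mul]
    congr 2
    push_cast
    ring
  ext i
  simp only [Jacobi, LapPerp, h.NZ_NZb_frame hf, h.NZb_NZ_frame hf, h.ricci hf, pairC_add_left,
    pairC_smul_left, h.pairC_Hopf_three, h.pairC_Hopf_four, h.pairC_conjV_Hopf_three,
    h.pairC_conjV_Hopf_four, hE]
  simp only [h.conjV_Hopf]
  simp only [h.Hopf_eq, Pi.add_apply, Pi.sub_apply, Pi.smul_apply, smul_eq_mul]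
  ring

end S4Frame

/-- the rotated Hopf fields `J Ω₁ = cosh θ · ψ₄` and `J Ω₂ = −sinh θ · ψ₃`
are Jacobi eigenfields: `𝓛(J Ω₁) = 2 J Ω₁` and `𝓛(J Ω₂) = 2 J Ω₂`. -/
theorem rotated_hopf_jacobi_eigenfields (f : ℂ → Fin 5 → ℝ) (ρ : ℂ → ℝ)
    (hf : IsConfMinImm f ρ)
    (ψ₃ ψ₄ : ℂ → Fin 5 → ℝ) (θ : ℂ → ℝ) (hframe : S4Frame f ρ ψ₃ ψ₄ θ) :
    (∀ (z : ℂ) (i : Fin 5),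
      Jacobi f ρ (fun w j => ((Real.cosh (θ w) : ℝ) : ℂ) * ((ψ₄ w j : ℝ) : ℂ)) z i =
        2 * (((Real.cosh (θ z) : ℝ) : ℂ) * ((ψ₄ z i : ℝ) : ℂ))) ∧
    (∀ (z : ℂ) (i : Fin 5),
      Jacobi f ρ (fun w j => -((Real.sinh (θ w) : ℝ) : ℂ) * ((ψ₃ w j : ℝ) : ℂ)) z i =
        2 * (-((Real.sinh (θ z) : ℝ) : ℂ) * ((ψ₃ z i : ℝ) : ℂ))) := by
  constructor
  · intro z i
    have e : (fun (w : ℂ) (j : Fin 5) => ((Real.cosh (θ w) : ℝ) : ℂ) * ((ψ₄ w j : ℝ) : ℂ)) =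
        fun w => ((0 : ℂ) * Complex.sinh (θ w)) • Fc ψ₃ w
          + ((1 : ℂ) * Complex.cosh (θ w)) • Fc ψ₄ w := by
      ext w j
      simp [Fc, cV]
    rw [e, hframe.Jacobi_rotated hf]
    simp [Fc, cV]
  · intro z i
    have e : (fun (w : ℂ) (j : Fin 5) => -((Real.sinh (θ w) : ℝ) : ℂ) * ((ψ₃ w j : ℝ) : ℂ)) =
        fun w => ((-1 : ℂ) * Complex.sinh (θ w)) • Fc ψ₃ w
          + ((0 : ℂ) * Complex.cosh (θ w)) • Fc ψ₄ w := by
      ext w j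
      simp [Fc, cV]
    rw [e, hframe.Jacobi_rotated hf]
    simp [Fc, cV]
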